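/- Let F : ℝ^d → ℝ be convex and differentiable and suppose F satisfies F(x) ≥ F(z) − ⟨∇F(x), z − x⟩ − (c/2)·‖x − z‖² for all x, z ∈ ℝ^d (with c = L·B·Δ in the sparse setting), and let R : ℝ^d → ℝ be convex, with P = F + R. Fix vectors u_k, x_k, x_{k−τ_k}, x* ∈ ℝ^d, a step size η > 0, set x_{k+1} = prox_{ηR}(x_k − η u_k) and g_k = (x_k − x_{k+1})/η. Then P(x*) ≥ P(x_{k+1}) + ⟨u_k − ∇F(x_{k−τ_k}), x_{k+1} − x*⟩ + η‖g_k‖² + ⟨g_k, x* − x_k⟩ − (c/2)·‖x_{k+1} − x_{k−τ_k}‖². -/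

import Mathlib

open Finset
open scoped BigOperators RealInnerProductSpace

/-- The first-order characterization of convexity: a convex function lies above each of its
tangent hyperplanes. -/
theorem ConvexOn.add_inner_gradient_le {E : Type*} [NormedAddCommGroup E]
    [InnerProductSpace ℝ E] [CompleteSpace E] {f : E → ℝ} (hf : ConvexOn ℝ Set.univ f)
    {x : E} (hfx : DifferentiableAt ℝ f x) (y : E) :
    f x + ⟪gradient f x, y - x⟫ ≤ f y := by
  have hconv : ConvexOn ℝ Set.univ (f ∘ AffineMap.lineMap (k := ℝ) x y) := by
    simpa using hf.comp_affineMap (AffineMap.lineMap (k := ℝ) x y)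
  have hderiv : HasDerivAt (f ∘ AffineMap.lineMap (k := ℝ) x y) ⟪gradient f x, y - x⟫ 0 := by
    have hfd : HasFDerivAt f (InnerProductSpace.toDual ℝ E (gradient f x))
        (AffineMap.lineMap (k := ℝ) x y 0) := by
      simpa using hfx.hasGradientAt.hasFDerivAt
    simpa using hfd.comp_hasDerivAt (0 : ℝ) AffineMap.hasDerivAt_lineMap
  have h := hconv.le_slope_of_hasDerivAt (Set.mem_univ 0) (Set.mem_univ 1) one_pos hderiv
  simp only [slope_def_field, Function.comp_apply, AffineMap.lineMap_apply_one,
    AffineMap.lineMap_apply_zero, sub_zero, div_one] at h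
  linarith

/-- Variational inequality for the proximal mapping: if `p` is the proximal point of `y` for the
convex function `η • R`, then `y - p` is a subgradient of `η • R` at `p`. -/
theorem ConvexOn.inner_sub_le_of_isMinOn_prox {E : Type*} [NormedAddCommGroup E]
    [InnerProductSpace ℝ E] {R : E → ℝ} (hR : ConvexOn ℝ Set.univ R) {η : ℝ} (hη : 0 ≤ η)
    {y p : E} (hp : IsMinOn (fun z => (1 / 2) * ‖z - y‖ ^ 2 + η * R z) Set.univ p) (x : E) :
    ⟪y - p, x - p⟫ ≤ η * (R x - R p) := by
  have key : ∀ t ∈ Set.Ioc (0 : ℝ) 1,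
      ⟪y - p, x - p⟫ - η * (R x - R p) ≤ t * (‖x - p‖ ^ 2 / 2) := by
    rintro t ⟨ht0, ht1⟩
    have hmin := isMinOn_iff.1 hp ((1 - t) • p + t • x) (Set.mem_univ _)
    have hconv := mul_le_mul_of_nonneg_left
      (hR.2 (Set.mem_univ p) (Set.mem_univ x) (sub_nonneg.2 ht1) ht0.le (by ring)) hη
    have hz : (1 - t) • p + t • x - y = t • (x - p) - (y - p) := by module
    have hnorm : ‖p - y‖ = ‖y - p‖ := norm_sub_rev p y
    simp only [smul_eq_mul] at hmin hconv
    rw [hz, hnorm, norm_sub_sq_real (t • (x - p)), norm_smul, real_inner_smul_left,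
      real_inner_comm, Real.norm_of_nonneg ht0.le] at hmin
    refine le_of_mul_le_mul_left ?_ ht0
    linarith
  have hlim : Filter.Tendsto (fun t : ℝ => t * (‖x - p‖ ^ 2 / 2)) (nhdsWithin 0 (Set.Ioi 0))
      (nhds 0) := by
    have h : Continuous fun t : ℝ => t * (‖x - p‖ ^ 2 / 2) := by fun_prop
    simpa using (h.tendsto 0).mono_left nhdsWithin_le_nhds
  have hle := ge_of_tendsto hlim
    (Filter.mem_of_superset (Ioc_mem_nhdsGT (zero_lt_one' ℝ)) key)
  linarith

/-- **One-step proximal inequality with a delayed gradient.**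
Let `F` be convex and differentiable satisfying the quadratic lower bound
`F x ≥ F z − ⟨∇F x, z − x⟩ − (c/2)‖x − z‖²` for all `x, z`, let `R` be convex, and
`P = F + R`.  If `x_{k+1} = prox_{ηR}(x_k − η u_k)` and `g_k = (x_k − x_{k+1})/η`, then
`P x* ≥ P x_{k+1} + ⟨u_k − ∇F x_{k−τ_k}, x_{k+1} − x*⟩ + η‖g_k‖² + ⟨g_k, x* − x_k⟩
       − (c/2)‖x_{k+1} − x_{k−τ_k}‖²`. -/
theorem prox_one_step_inequality
    (d : ℕ) (F R P : EuclideanSpace ℝ (Fin d) → ℝ) (c η : ℝ) (hη : 0 < η)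
    (hFconv : ConvexOn ℝ Set.univ F) (hFdiff : Differentiable ℝ F)
    (hRconv : ConvexOn ℝ Set.univ R)
    (hquad : ∀ x z : EuclideanSpace ℝ (Fin d),
      F x ≥ F z - ⟪gradient F x, z - x⟫ - (c / 2) * ‖x - z‖ ^ 2)
    (hP : P = fun x => F x + R x)
    (uk xk xdel xstar xk1 gk : EuclideanSpace ℝ (Fin d))
    (hprox : IsMinOn (fun z => (1 / 2) * ‖z - (xk - η • uk)‖ ^ 2 + η * R z)
      Set.univ xk1)
    (hg : gk = η⁻¹ • (xk - xk1)) :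
    P xstar ≥ P xk1 + ⟪uk - gradient F xdel, xk1 - xstar⟫ + η * ‖gk‖ ^ 2
      + ⟪gk, xstar - xk⟫ - (c / 2) * ‖xk1 - xdel‖ ^ 2 := by
  subst hP
  have hF := hFconv.add_inner_gradient_le (hFdiff xdel) xstar
  have hq := hquad xdel xk1
  rw [norm_sub_rev] at hq
  have hR := hRconv.inner_sub_le_of_isMinOn_prox hη.le hprox xstar
  have hstep : xk = xk1 + η • gk := by
    rw [hg, smul_inv_smul₀ hη.ne']
    abel
  have hres : xk - η • uk - xk1 = η • (gk - uk) := by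
    rw [hstep]
    module
  rw [hres, real_inner_smul_left] at hR
  have hR' := le_of_mul_le_mul_left hR hη
  rw [hstep]
  simp only [inner_sub_left, inner_sub_right, inner_add_right, real_inner_smul_right,
    real_inner_self_eq_norm_sq] at hF hq hR' ⊢
  linarith
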